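/- Let m ≥ 1 be an integer and B ~ Binomial(m, 1/2). Then E[|B − m/2|³] ≤ m^{3/2} / √(8π). -/

import Mathlib

open MeasureTheory ProbabilityTheory

/-- The distribution of a `Binomial(n, 1/2)` random variable, as a measure on `ℕ`. -/
noncomputable def binomHalf (n : ℕ) : Measure ℕ :=
  ((PMF.binomial (1/2) (by norm_num) n).map Fin.val).toMeasure

instance (n : ℕ) : IsProbabilityMeasure (binomHalf n) := by
  unfold binomHalf; infer_instance

/-- The Wallis product expressed through central binomial coefficients. -/
theorem centralBinom_sq_mul_wallis (n : ℕ) :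
    (n.centralBinom : ℝ) ^ 2 * (2 * n + 1) * Real.Wallis.W n = (4 ^ n) ^ 2 := by
  induction n with
  | zero => simp [Real.Wallis.W]
  | succ n ih =>
    have h : ((n : ℝ) + 1) * (n + 1).centralBinom = 2 * (2 * n + 1) * n.centralBinom := by
      exact_mod_cast Nat.succ_mul_centralBinom_succ n
    have hc : ((n + 1).centralBinom : ℝ) = 2 * (2 * n + 1) * n.centralBinom / (n + 1) := by
      rw [← h]; field_simp
    rw [Real.Wallis.W_succ, hc, pow_succ (4 : ℝ) n, mul_pow, ← ih]
    push_cast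
    field_simp
    ring

open Filter Topology in
theorem pi_div_four_le_wallis (n : ℕ) :
    Real.pi / 4 ≤ Real.Wallis.W n * ((2 * n + 1) / (4 * n + 1)) := by
  have hanti : Antitone fun k : ℕ => Real.Wallis.W k * ((2 * (k : ℝ) + 1) / (4 * k + 1)) := by
    refine antitone_nat_of_succ_le fun k => ?_
    rw [Real.Wallis.W_succ, mul_assoc]
    refine mul_le_mul_of_nonneg_left ?_ (Real.Wallis.W_pos k).le
    push_cast
    rw [div_mul_div_comm, div_mul_div_comm, div_le_div_iff₀ (by positivity) (by positivity)]
    have hk : (0 : ℝ) ≤ k := k.cast_nonneg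
    have : 0 ≤ (2 * (k : ℝ) + 1) * (2 * k + 3) := by positivity
    nlinarith
  have hlim : Tendsto (fun k : ℕ => (2 * (k : ℝ) + 1) / (4 * k + 1)) atTop (𝓝 (1 / 2)) := by
    have h : Tendsto (fun k : ℕ => (2 + 1 / (k : ℝ)) / (4 + 1 / (k : ℝ))) atTop
        (𝓝 ((2 + 0) / (4 + 0))) :=
      (tendsto_const_nhds.add tendsto_one_div_atTop_nhds_zero_nat).div
        (tendsto_const_nhds.add tendsto_one_div_atTop_nhds_zero_nat) (by norm_num)
    have h' : ((2 : ℝ) + 0) / (4 + 0) = 1 / 2 := by norm_num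
    rw [h'] at h
    refine h.congr' ?_
    filter_upwards [eventually_gt_atTop 0] with k hk
    have : (0 : ℝ) < k := by exact_mod_cast hk
    field_simp
  have := hanti.le_of_tendsto (Real.Wallis.tendsto_W_nhds_pi_div_two.mul hlim) n
  linarith

/-- A sharp form of the bound `centralBinom n / 4 ^ n ≤ 1 / √(π (n + 1 / 4))`. -/
theorem pi_mul_centralBinom_sq_le (n : ℕ) :
    Real.pi * (4 * n + 1) * (n.centralBinom : ℝ) ^ 2 ≤ 4 * (4 ^ n) ^ 2 := by
  have h := pi_div_four_le_wallis n
  rw [mul_div_assoc', le_div_iff₀ (by positivity)] at h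
  rw [← centralBinom_sq_mul_wallis n]
  nlinarith [mul_le_mul_of_nonneg_left h (sq_nonneg (n.centralBinom : ℝ))]

theorem sum_range_centered_cube_mul_choose (m j : ℕ) (hj : j ≤ m + 1) :
    ∑ k ∈ Finset.range j, (2 * (k : ℝ) - m) ^ 3 * m.choose k =
      -(((2 * (j : ℝ) - m - 1) ^ 2 + 2 * m - 1) * (j * m.choose j)) := by
  induction j with
  | zero => simp
  | succ j ih =>
    have h : ((j : ℝ) + 1) * m.choose (j + 1) = m.choose j * (m - j) := by
      have := Nat.choose_succ_right_eq m j
      rw [← Nat.cast_sub (by omega : j ≤ m)]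
      rw [mul_comm]
      exact_mod_cast this
    rw [Finset.sum_range_succ, ih (by omega)]
    push_cast
    rw [h]
    ring

theorem sum_abs_centered_cube_mul_choose (m j : ℕ) (h1 : m ≤ 2 * j) (h2 : 2 * j ≤ m + 2)
    (hj : j ≤ m + 1) :
    ∑ k ∈ Finset.range (m + 1), |2 * (k : ℝ) - m| ^ 3 * m.choose k =
      2 * (((2 * (j : ℝ) - m - 1) ^ 2 + 2 * m - 1) * (j * m.choose j)) := by
  have hall := sum_range_centered_cube_mul_choose m (m + 1) le_rfl
  have hlow := sum_range_centered_cube_mul_choose m j hj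
  rw [Nat.choose_succ_self, Nat.cast_zero, mul_zero, mul_zero, neg_zero,
    ← Finset.sum_range_add_sum_Ico _ hj] at hall
  have hneg : ∑ k ∈ Finset.range j, |2 * (k : ℝ) - m| ^ 3 * m.choose k =
      -∑ k ∈ Finset.range j, (2 * (k : ℝ) - m) ^ 3 * m.choose k := by
    rw [← Finset.sum_neg_distrib]
    refine Finset.sum_congr rfl fun k hk => ?_
    have : 2 * (k : ℝ) ≤ m := by
      have := Finset.mem_range.mp hk
      exact_mod_cast (by omega : 2 * k ≤ m)
    rw [abs_of_nonpos (by linarith)]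
    ring
  have hpos : ∑ k ∈ Finset.Ico j (m + 1), |2 * (k : ℝ) - m| ^ 3 * m.choose k =
      ∑ k ∈ Finset.Ico j (m + 1), (2 * (k : ℝ) - m) ^ 3 * m.choose k := by
    refine Finset.sum_congr rfl fun k hk => ?_
    have : (m : ℝ) ≤ 2 * k := by
      have := (Finset.mem_Ico.mp hk).1
      exact_mod_cast (by omega : m ≤ 2 * k)
    rw [abs_of_nonneg (by linarith)]
  rw [← Finset.sum_range_add_sum_Ico _ hj, hneg, hpos]
  linarith

theorem integral_binomHalf (m : ℕ) (f : ℕ → ℝ) :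
    ∫ k, f k ∂(binomHalf m) =
      (∑ k ∈ Finset.range (m + 1), f k * m.choose k) / 2 ^ m := by
  unfold binomHalf
  rw [← PMF.toMeasure_map _ _ (measurable_of_finite _),
    integral_map (measurable_of_finite _).aemeasurable
      (measurable_of_countable f).aestronglyMeasurable,
    PMF.integral_eq_sum, ← Fin.sum_univ_eq_sum_range (fun k => f k * (m.choose k : ℝ)),
    Finset.sum_div]
  refine Finset.sum_congr rfl fun k _ => ?_
  have hk : (k : ℕ) + (m - k) = m := by omega
  have hhalf : (1 : ENNReal).toReal - ((1 / 2 : NNReal) : ENNReal).toReal = 1 / 2 := by norm_num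
  rw [PMF.binomial_apply, ENNReal.toReal_mul, ENNReal.toReal_mul, ENNReal.toReal_pow,
    ENNReal.toReal_pow, ENNReal.toReal_sub_of_le (by norm_num) ENNReal.one_ne_top, hhalf,
    ENNReal.toReal_natCast, ENNReal.coe_toReal, NNReal.coe_div, NNReal.coe_one, NNReal.coe_ofNat,
    Fin.val_last, ← pow_add, hk, one_div, inv_pow, smul_eq_mul]
  ring

theorem integral_abs_centered_cube_binomHalf (m j : ℕ) (h1 : m ≤ 2 * j) (h2 : 2 * j ≤ m + 2)
    (hj : j ≤ m + 1) :
    ∫ k, |(k : ℝ) - m / 2| ^ 3 ∂(binomHalf m) =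
      ((2 * (j : ℝ) - m - 1) ^ 2 + 2 * m - 1) * (j * m.choose j) / (4 * 2 ^ m) := by
  have h (k : ℕ) : |(k : ℝ) - m / 2| ^ 3 = |2 * (k : ℝ) - m| ^ 3 / 8 := by
    have : (k : ℝ) - m / 2 = (2 * k - m) / 2 := by ring
    rw [this, abs_div, div_pow]
    norm_num
  rw [integral_binomHalf]
  simp_rw [h, div_mul_eq_mul_div]
  rw [← Finset.sum_div, sum_abs_centered_cube_mul_choose m j h1 h2 hj]
  field_simp
  ring

/-- **Bound on the third absolute central moment of the binomial.** For
`m ≥ 1` and `B ~ Binomial(m, 1/2)`, `E[|B - m/2|³] ≤ m^{3/2} / √(8π)`. -/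
theorem statement_17 (m : ℕ) (hm : 1 ≤ m) :
    (∫ k, |(k : ℝ) - m/2|^3 ∂(binomHalf m)) ≤
      (m : ℝ) ^ ((3:ℝ)/2) / Real.sqrt (8 * Real.pi) := by
  have hpi := Real.pi_pos
  have hpow : (m : ℝ) ^ ((3 : ℝ) / 2) = Real.sqrt ((m : ℝ) ^ 3) := by
    rw [Real.sqrt_eq_rpow, ← Real.rpow_natCast, ← Real.rpow_mul m.cast_nonneg]
    norm_num
  rw [hpow, ← Real.sqrt_div (by positivity)]
  refine Real.le_sqrt_of_sq_le ?_
  rw [le_div_iff₀ (by positivity)]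
  obtain ⟨n, rfl | rfl⟩ := m.even_or_odd'
  · rw [integral_abs_centered_cube_binomHalf (2 * n) n le_rfl (by omega) (by omega),
      ← Nat.centralBinom_eq_two_mul_choose, pow_mul, div_pow, div_mul_eq_mul_div,
      div_le_iff₀ (by positivity)]
    have hb := pi_mul_centralBinom_sq_le n
    have hc : Real.pi * n * (n.centralBinom : ℝ) ^ 2 ≤ (4 ^ n) ^ 2 := by
      nlinarith [mul_nonneg hpi.le (sq_nonneg (n.centralBinom : ℝ))]
    have h := mul_le_mul_of_nonneg_left hc (by positivity : (0 : ℝ) ≤ 128 * n ^ 3)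
    push_cast
    norm_num
    nlinarith
  · rw [integral_abs_centered_cube_binomHalf (2 * n + 1) (n + 1) (by omega) (by omega) (by omega),
      pow_succ (2 : ℝ) (2 * n), pow_mul, div_pow, div_mul_eq_mul_div, div_le_iff₀ (by positivity)]
    have hch : ((n + 1 : ℕ) : ℝ) * ((2 * n + 1).choose (n + 1) : ℝ) =
        (2 * n + 1) * n.centralBinom := by
      rw [Nat.centralBinom_eq_two_mul_choose, mul_comm]
      exact_mod_cast (Nat.add_one_mul_choose_eq (2 * n) n).symm
    rw [hch]
    have hb := pi_mul_centralBinom_sq_le n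
    have h := mul_le_mul_of_nonneg_left hb
      (by positivity : (0 : ℝ) ≤ 8 * (2 * n + 1) ^ 2 * (4 * n + 1))
    have h' : 0 ≤ ((2 * n + 1) ^ 2 * (4 ^ n) ^ 2 : ℝ) := by positivity
    push_cast
    norm_num
    nlinarith
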